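/- arXiv:1909.10440 — 3 statements merged into one kernel-verified Lean document; each statement's English description precedes it below -/
import Mathlib

section
/- For every α ∈ [0, π/2], the inequality (1/2)[sin²((α+π/2)/2) + cos²((α−π/2)/2)] ≥ cos²(α/4) holds if and only if α ≥ π/3. -/
/- STATEMENT 3: for α ∈ [0, π/2], the entanglement-assisted success probability
   with α′ = π/2 beats the unassisted optimum cos²(α/4) if and only if α ≥ π/3. -/

theorem stmt3 (α : ℝ) (h0 : 0 ≤ α) (h1 : α ≤ Real.pi / 2) :
    (1 / 2) * (Real.sin ((α + Real.pi / 2) / 2) ^ 2 + Real.cos ((α - Real.pi / 2) / 2) ^ 2)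
      ≥ Real.cos (α / 4) ^ 2 ↔ α ≥ Real.pi / 3 := by
  have hπ := Real.pi_pos
  have hcos : Real.cos (α / 2) ≤ Real.cos (Real.pi / 2 - α) ↔ Real.pi / 2 - α ≤ α / 2 :=
    Real.strictAntiOn_cos.le_iff_ge ⟨by linarith, by linarith⟩ ⟨by linarith, by linarith⟩
  rw [Real.cos_pi_div_two_sub] at hcos
  rw [Real.sin_sq_eq_half_sub, Real.cos_sq ((α - Real.pi / 2) / 2), Real.cos_sq (α / 4),
    mul_div_cancel₀ (α + Real.pi / 2) two_ne_zero, mul_div_cancel₀ (α - Real.pi / 2) two_ne_zero,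
    show 2 * (α / 4) = α / 2 by ring, Real.cos_add_pi_div_two, Real.cos_sub_pi_div_two]
  constructor
  · intro h
    linarith [hcos.1 (by linarith)]
  · intro h
    linarith [hcos.2 (by linarith)]
end

section
/- Fix α ∈ [0, π/2] and consider the four two-qubit product states ψ̃₁=|0⟩⊗|0⟩, ψ̃₂=|0⟩⊗|1⟩, ψ̃₃=|1⟩⊗(cos(α/2)|0⟩+sin(α/2)|1⟩), ψ̃₄=|1⟩⊗(sin(α/2)|0⟩−cos(α/2)|1⟩), and write ψ̃_i = A_i ⊗ B_i with A_i, B_i unit vectors in ℂ². There exist an orthonormal basis {e_x}_{x∈Fin 2} of ℂ² (Alice, used on both copies), orthonormal bases {f_y}_{y∈Fin 2} and {g_z}_{z∈Fin 2} of ℂ² (Bob, used on copy 1 and copy 2 respectively), and a decoder D : Fin 2 × Fin 2 × Fin 2 → Fin 4 such that for every i ∈ Fin 4, Σ_{(x,y,z): D(x,y,z)=i} |⟨e_x, A_i⟩|² · |⟨f_y, B_i⟩|² · |⟨g_z, B_i⟩|² = 1. That is, two identical copies suffice to perfectly distinguish any two-qubit product basis by fixed local projective measurements without communication during the measurements. 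-/
/- STATEMENT 4: any two-qubit product basis (written in the canonical α-form
   ψ̃_i = A_i ⊗ B_i) can be perfectly distinguished by fixed local projective
   measurements on two identical copies, without communication during the
   measurements. -/

noncomputable section
open scoped ComplexConjugate

abbrev Qubit : Type := EuclideanSpace ℂ (Fin 2)

/-- standard basis of ℂ² -/
def ket (i : Fin 2) : Qubit := EuclideanSpace.single i 1

/-- Alice's parts of the product basis -/
def Apart : Fin 4 → Qubit := ![ket 0, ket 0, ket 1, ket 1]

/-- Bob's parts of the product basis, parameterized by α -/
def Bpart (α : ℝ) : Fin 4 → Qubit :=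
  ![ket 0,
    ket 1,
    (Real.cos (α / 2) : ℂ) • ket 0 + (Real.sin (α / 2) : ℂ) • ket 1,
    (Real.sin (α / 2) : ℂ) • ket 0 - (Real.cos (α / 2) : ℂ) • ket 1]

theorem ket_orthonormal : Orthonormal ℂ ket := by
  have h : ket = EuclideanSpace.basisFun (Fin 2) ℂ := by
    ext1 i
    simp [ket]
  exact h ▸ (EuclideanSpace.basisFun (Fin 2) ℂ).orthonormal

/-- Bob's rotated basis, in which his third and fourth parts are the basis vectors. -/
def rotatedKet (α : ℝ) : Fin 2 → Qubit := ![Bpart α 2, Bpart α 3]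

theorem rotatedKet_orthonormal (α : ℝ) : Orthonormal ℂ (rotatedKet α) := by
  have h : (Real.cos (α / 2) : ℂ) * Real.cos (α / 2) +
      Real.sin (α / 2) * Real.sin (α / 2) = 1 := by
    norm_cast
    linear_combination Real.cos_sq_add_sin_sq (α / 2)
  rw [orthonormal_iff_ite]
  intro i j
  fin_cases i <;> fin_cases j <;>
    simp [rotatedKet, Bpart, ket, PiLp.inner_apply, Fin.sum_univ_two,
      -inner_self_eq_norm_sq_to_K, -Complex.ofReal_cos, -Complex.ofReal_sin] <;>
    first | ring1 | linear_combination h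

theorem sum_norm_inner_sq_eq_one {b : Fin 2 → Qubit} (hb : Orthonormal ℂ b) {v : Qubit}
    (hv : ‖v‖ = 1) :
    ‖(inner ℂ (b 0) v : ℂ)‖ ^ 2 + ‖(inner ℂ (b 1) v : ℂ)‖ ^ 2 = 1 := by
  let B := (basisOfOrthonormalOfCardEqFinrank hb (by simp)).toOrthonormalBasis
    (by simpa using hb)
  have h := B.sum_sq_norm_inner_right v
  simpa [B, Fin.sum_univ_two, hv] using h

theorem stmt4 (α : ℝ) (h0 : 0 ≤ α) (h1 : α ≤ Real.pi / 2) :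
    ∃ (e f g : Fin 2 → Qubit) (D : Fin 2 × Fin 2 × Fin 2 → Fin 4),
      Orthonormal ℂ e ∧ Orthonormal ℂ f ∧ Orthonormal ℂ g ∧
      ∀ i : Fin 4,
        (∑ o : Fin 2 × Fin 2 × Fin 2,
          if D o = i then
            ‖(@inner ℂ _ _ (e o.1) (Apart i) : ℂ)‖ ^ 2 *
            ‖(@inner ℂ _ _ (f o.2.1) (Bpart α i) : ℂ)‖ ^ 2 *
            ‖(@inner ℂ _ _ (g o.2.2) (Bpart α i) : ℂ)‖ ^ 2
          else 0) = 1 := by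
  have hk := ket_orthonormal
  have hr := rotatedKet_orthonormal α
  have hkk := orthonormal_iff_ite.1 hk
  have hrr := orthonormal_iff_ite.1 hr
  have e2 : Bpart α 2 = rotatedKet α 0 := rfl
  have e3 : Bpart α 3 = rotatedKet α 1 := rfl
  refine ⟨ket, ket, rotatedKet α, fun o => if o.1 = 0 then ![0, 1] o.2.1 else ![2, 3] o.2.2,
    hk, hk, hr, fun i => ?_⟩
  have r0 := sum_norm_inner_sq_eq_one hr (hk.1 0)
  have r1 := sum_norm_inner_sq_eq_one hr (hk.1 1)
  have k0 := sum_norm_inner_sq_eq_one hk (hr.1 0)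
  have k1 := sum_norm_inner_sq_eq_one hk (hr.1 1)
  have b0 : Bpart α 0 = ket 0 := rfl
  have b1 : Bpart α 1 = ket 1 := rfl
  fin_cases i <;>
    simp [Fintype.sum_prod_type, Fin.sum_univ_two, Apart, hkk, hrr, e2, e3, b0, b1] <;>
    assumption
end
end

section
/- Let a ≥ b > 0 with a² + b² = 1, and let u₊ = a|0⟩ + b|1⟩ and u₋ = a|0⟩ − b|1⟩ in ℂ². Then for every orthonormal basis {f₀, f₁} of ℂ², (1/2)|⟨f₀, u₊⟩|² + (1/2)|⟨f₁, u₋⟩|² ≤ 1/2 + ab, and there exists an orthonormal basis {f₀, f₁} of ℂ² achieving equality. That is, the optimal minimal-error success probability for discriminating the equiprobable pair u₊, u₋ by a projective measurement equals 1/2 + ab. -/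
/- STATEMENT 8: for u₊ = a|0⟩+b|1⟩, u₋ = a|0⟩−b|1⟩ with a ≥ b > 0, a²+b²=1,
   every projective measurement {f₀,f₁} has success probability
   (1/2)|⟨f₀,u₊⟩|² + (1/2)|⟨f₁,u₋⟩|² ≤ 1/2 + ab, and some orthonormal basis
   attains 1/2 + ab. -/

noncomputable section
open scoped ComplexConjugate

theorem norm_inner_ket_add_sq (g : Qubit) (a b : ℝ) :
    ‖(@inner ℂ _ _ g ((a : ℂ) • ket 0 + (b : ℂ) • ket 1) : ℂ)‖ ^ 2 =
      (a * (g 0).re + b * (g 1).re) ^ 2 + (a * (g 0).im + b * (g 1).im) ^ 2 := by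
  rw [Complex.sq_norm, Complex.normSq_apply]
  simp [ket, EuclideanSpace.inner_single_right]
  ring

theorem norm_inner_ket_sub_sq (g : Qubit) (a b : ℝ) :
    ‖(@inner ℂ _ _ g ((a : ℂ) • ket 0 - (b : ℂ) • ket 1) : ℂ)‖ ^ 2 =
      (a * (g 0).re - b * (g 1).re) ^ 2 + (a * (g 0).im - b * (g 1).im) ^ 2 := by
  have h := norm_inner_ket_add_sq g a (-b)
  push_cast at h
  rw [neg_smul, ← sub_eq_add_neg] at h
  rw [h]
  ring

theorem Qubit.norm_sq_eq (g : Qubit) :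
    ‖g‖ ^ 2 = (g 0).re ^ 2 + (g 0).im ^ 2 + ((g 1).re ^ 2 + (g 1).im ^ 2) := by
  rw [EuclideanSpace.norm_sq_eq, Fin.sum_univ_two, Complex.sq_norm, Complex.sq_norm,
    Complex.normSq_apply, Complex.normSq_apply]
  ring

/-- The measurement basis (|0⟩ ± |1⟩)/√2. -/
def hadamardBasis : Fin 2 → Qubit :=
  ![!₂[((√2)⁻¹ : ℝ), ((√2)⁻¹ : ℝ)], !₂[((√2)⁻¹ : ℝ), (-(√2)⁻¹ : ℝ)]]

theorem orthonormal_hadamardBasis : Orthonormal ℂ hadamardBasis := by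
  have h : ((√2)⁻¹ : ℝ) ^ 2 = 1 / 2 := by
    rw [inv_pow, Real.sq_sqrt (by norm_num)]
    norm_num
  constructor
  · intro i
    rw [← sq_eq_sq₀ (norm_nonneg _) zero_le_one, Qubit.norm_sq_eq]
    fin_cases i <;> simp [hadamardBasis, -Complex.ofReal_inv, -inv_pow, h] <;> norm_num
  · intro i j hij
    fin_cases i <;> fin_cases j <;>
      simp_all [hadamardBasis, PiLp.inner_apply, Fin.sum_univ_two]

theorem stmt8 (a b : ℝ) (hb : 0 < b) (hab : b ≤ a) (hnorm : a ^ 2 + b ^ 2 = 1) :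
    (∀ f : Fin 2 → Qubit, Orthonormal ℂ f →
      (1 / 2) * ‖(@inner ℂ _ _ (f 0) ((a : ℂ) • ket 0 + (b : ℂ) • ket 1) : ℂ)‖ ^ 2 +
      (1 / 2) * ‖(@inner ℂ _ _ (f 1) ((a : ℂ) • ket 0 - (b : ℂ) • ket 1) : ℂ)‖ ^ 2
        ≤ 1 / 2 + a * b) ∧
    (∃ f : Fin 2 → Qubit, Orthonormal ℂ f ∧
      (1 / 2) * ‖(@inner ℂ _ _ (f 0) ((a : ℂ) • ket 0 + (b : ℂ) • ket 1) : ℂ)‖ ^ 2 +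
      (1 / 2) * ‖(@inner ℂ _ _ (f 1) ((a : ℂ) • ket 0 - (b : ℂ) • ket 1) : ℂ)‖ ^ 2
        = 1 / 2 + a * b) := by
  constructor
  · intro f hf
    have hbessel := hf.sum_inner_products_le ((a : ℂ) • ket 0 - (b : ℂ) • ket 1)
      (s := Finset.univ)
    have hnorm_f := Qubit.norm_sq_eq (f 0)
    rw [hf.1 0] at hnorm_f
    have hnorm_sub : ‖(a : ℂ) • ket 0 - (b : ℂ) • ket 1‖ ^ 2 = 1 := by
      rw [Qubit.norm_sq_eq]
      simpa [ket] using hnorm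
    rw [Fin.sum_univ_two, hnorm_sub, norm_inner_ket_sub_sq (f 0)] at hbessel
    rw [norm_inner_ket_add_sq]
    have hpos : 0 ≤ a * b := mul_nonneg (hb.le.trans hab) hb.le
    have hre := mul_nonneg hpos (sq_nonneg ((f 0 0).re - (f 0 1).re))
    have him := mul_nonneg hpos (sq_nonneg ((f 0 0).im - (f 0 1).im))
    have hscale := congrArg (a * b * ·) hnorm_f
    dsimp only at hscale
    linarith
  · refine ⟨hadamardBasis, orthonormal_hadamardBasis, ?_⟩
    rw [norm_inner_ket_add_sq, norm_inner_ket_sub_sq]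
    have h : ((√2)⁻¹ : ℝ) ^ 2 = 1 / 2 := by
      rw [inv_pow, Real.sq_sqrt (by norm_num)]
      norm_num
    simp only [hadamardBasis, Matrix.cons_val_zero, Matrix.cons_val_one,
      Complex.ofReal_re, Complex.ofReal_im]
    linear_combination (a + b) ^ 2 * h + hnorm / 2
end
end
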